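/- With the quantum cluster setup below, for every n ∈ ℤ the cluster variable X_n lies in the subsemiring of D generated by v, v^{−1}, X_1, X_1^{−1}, X_2, X_2^{−1}. (This expresses that all coefficients of the quantum Laurent expression for X_n in terms of X_1 and X_2 are nonnegative: X_n is a sum of monomials in q^{±1/2}, X_1^{±1}, X_2^{±1} with no subtraction.) -/

import Mathlib

section QuantumPositivity

variable {K D : Type*} [Field K] [DivisionRing D] [Algebra K D]

/-- The elements `x` and `y` commute up to the scalar `v ^ n`. -/
def QCommute (v : K) (n : ℤ) (x y : D) : Prop := x * y = v ^ n • (y * x)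

namespace QCommute

variable {v : K} {m n : ℤ} {x y z : D}

lemma eq (h : QCommute v n x y) : x * y = v ^ n • (y * x) := h

lemma symm (hv : v ≠ 0) (h : QCommute v n x y) : QCommute v (-n) y x := by
  simp only [QCommute] at *
  rw [h, smul_smul, ← zpow_add₀ hv]
  simp

lemma inv_right (hy : y ≠ 0) (hv : v ≠ 0) (h : QCommute v n x y) : QCommute v (-n) x y⁻¹ := by
  have h' : x = v ^ n • (y * x * y⁻¹) := by
    rw [← smul_mul_assoc, ← h, mul_inv_cancel_right₀ hy]
  simp only [QCommute]
  rw [eq_comm]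
  conv_lhs => rw [h']
  rw [mul_smul_comm, smul_smul, ← zpow_add₀ hv, mul_assoc y, inv_mul_cancel_left₀ hy]
  simp

lemma inv_left (hx : x ≠ 0) (hv : v ≠ 0) (h : QCommute v n x y) : QCommute v (-n) x⁻¹ y := by
  simpa using ((h.symm hv).inv_right hx hv).symm hv

lemma mul_right (hv : v ≠ 0) (h : QCommute v m x y) (h' : QCommute v n x z) :
    QCommute v (m + n) x (y * z) := by
  simp only [QCommute] at *
  rw [← mul_assoc, h, smul_mul_assoc, mul_assoc, h', mul_smul_comm, smul_smul, zpow_add₀ hv,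
    mul_assoc]

lemma pow_right (hv : v ≠ 0) (h : QCommute v n x y) (i : ℕ) : QCommute v (i * n) x (y ^ i) := by
  induction i with
  | zero => simp [QCommute]
  | succ i ih =>
    rw [pow_succ]
    convert ih.mul_right hv h using 1
    push_cast
    ring

lemma pow_left (hv : v ≠ 0) (h : QCommute v n x y) (i : ℕ) : QCommute v (i * n) (x ^ i) y := by
  simpa using ((h.symm hv).pow_right hv i).symm hv

end QCommute

/-- The expression `b⁻¹ * (c ^ j + a ^ s)` with the quantum weights making it a Laurent
polynomial when `a`, `b`, `c` are consecutive cluster variables and `j + s = k + 2`. -/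
def truncation (v : K) (k : ℕ) (a b c : D) (j s : ℕ) : D :=
  b⁻¹ * (v ^ ((k : ℤ) + 2 - 2 * s) • c ^ j + v ^ (-2 * (s : ℤ)) • a ^ s)

lemma mul_truncation {v : K} (hv : v ≠ 0) {k : ℕ} {a b c : D} (hb : b ≠ 0)
    (hbc : QCommute v 2 b c) (hca : c * a = v ^ (-(k : ℤ) - 2) • b ^ (k + 2) + 1) (j s : ℕ) :
    c * truncation v k a b c j (s + 1) = truncation v k a b c (j + 1) s +
      v ^ (-2 * (s : ℤ) - k - 2) • (b ^ (k + 1) * a ^ s) := by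
  have h1 : QCommute v 2 c b⁻¹ := by
    simpa using (hbc.symm hv).inv_right hb hv
  have h2 : c * a ^ (s + 1) = v ^ (-(k : ℤ) - 2) • (b * (b ^ (k + 1) * a ^ s)) + a ^ s := by
    rw [pow_succ', ← mul_assoc, hca, add_mul, one_mul, smul_mul_assoc, pow_succ' b, mul_assoc]
  simp only [truncation]
  rw [← mul_assoc, h1.eq, smul_mul_assoc, mul_assoc, mul_add, mul_smul_comm, mul_smul_comm, h2,
    ← pow_succ']
  simp only [mul_add, mul_smul_comm, smul_add, smul_smul, inv_mul_cancel_left₀ hb,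
    ← zpow_add₀ hv]
  rw [show 2 + ((k : ℤ) + 2 - 2 * (s + 1 : ℕ)) = k + 2 - 2 * s by push_cast; ring,
    show 2 + (-2 * ((s + 1 : ℕ) : ℤ) + (-k - 2)) = -2 * s - k - 2 by push_cast; ring,
    show 2 + -2 * ((s + 1 : ℕ) : ℤ) = -2 * s by push_cast; ring]
  abel

lemma truncation_shift {v : K} (hv : v ≠ 0) {k : ℕ} {a b c d : D} (hb : b ≠ 0) (hc : c ≠ 0)
    (hbc : QCommute v 2 b c) (hac : a * c = v ^ ((k : ℤ) + 2) • b ^ (k + 2) + 1)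
    (hbd : b * d = v ^ ((k : ℤ) + 2) • c ^ (k + 2) + 1) :
    truncation v k b c d 1 (k + 1) = v ^ (-(k : ℤ)) • truncation v k a b c (k + 1) 1 := by
  have h1 : QCommute v (-2) c⁻¹ b⁻¹ := by
    simpa using ((hbc.symm hv).inv_right hb hv).inv_left hc hv
  have h2 : c⁻¹ * b ^ (k + 1) = v ^ (2 * (k : ℤ) + 2) • (b ^ (k + 1) * c⁻¹) := by
    have := ((hbc.symm hv).inv_left hc hv).pow_right hv (k + 1)
    simp only [QCommute] at this
    rw [this]
    congr 2
    push_cast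
    ring
  have ha : a = v ^ ((k : ℤ) + 2) • (b * (b ^ (k + 1) * c⁻¹)) + c⁻¹ := by
    rw [← mul_inv_cancel_right₀ hc a, hac, add_mul, one_mul, smul_mul_assoc, pow_succ' b,
      mul_assoc]
  have hd : d = v ^ ((k : ℤ) + 2) • (b⁻¹ * c ^ (k + 2)) + b⁻¹ := by
    rw [← inv_mul_cancel_left₀ hb d, hbd, mul_add, mul_one, mul_smul_comm]
  have h3 : c⁻¹ * (b⁻¹ * c ^ (k + 2)) = v ^ (-2 : ℤ) • (b⁻¹ * c ^ (k + 1)) := by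
    rw [← mul_assoc, h1.eq, smul_mul_assoc, mul_assoc, pow_succ' c, inv_mul_cancel_left₀ hc]
  simp only [truncation, pow_one]
  rw [ha, hd]
  simp only [mul_add, mul_smul_comm, smul_add, smul_smul, inv_mul_cancel_left₀ hb, h1.eq, h2, h3,
    ← zpow_add₀ hv]
  push_cast
  ring_nf
  abel

lemma Subsemiring.mul_sub_mul_mem {R : Type*} [Ring R] {S : Subsemiring R} {x x' y y' : R}
    (hx : x - x' ∈ S) (hx' : x' ∈ S) (hy : y - y' ∈ S) (hy' : y' ∈ S) :
    x * y - x' * y' ∈ S := by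
  have h : x * y - x' * y' = (x - x') * (y - y') + (x - x') * y' + x' * (y - y') := by
    noncomm_ring
  rw [h]
  exact add_mem (add_mem (mul_mem hx hy) (mul_mem hx hy')) (mul_mem hx' hy)

lemma Subsemiring.pow_sub_pow_mem {R : Type*} [Ring R] {S : Subsemiring R} {x y : R}
    (h : x - y ∈ S) (hy : y ∈ S) (n : ℕ) : x ^ n - y ^ n ∈ S := by
  induction n with
  | zero => simp
  | succ n ih =>
    rw [pow_succ, pow_succ]
    exact mul_sub_mul_mem ih (pow_mem hy n) h hy

/-- Lower bounds, in the order whose positive cone is `S`, for three consecutive cluster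
variables `a`, `b`, `c` and for `truncation v k a b c 1 (k + 1)`, in terms of the
`v`-commuting monomials `E` and `ε`. -/
structure PositiveSeed (v : K) (k : ℕ) (S : Subsemiring D) (a b c E ε : D) : Prop where
  E_ne : E ≠ 0
  ε_ne : ε ≠ 0
  comm : QCommute v 2 E ε
  E_mem : E ∈ S
  E_inv_mem : E⁻¹ ∈ S
  ε_mem : ε ∈ S
  ε_inv_mem : ε⁻¹ ∈ S
  left : a - E⁻¹ ∈ S
  middle : b - (E ^ (k + 1) * ε)⁻¹ ∈ S
  right : c - (E + v ^ (-3 * (k : ℤ) - 2) • (b ^ (k + 1) * a ^ k * ε⁻¹)) ∈ S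
  trunc : truncation v k a b c 1 (k + 1) -
    (ε + v ^ (-2 * (k : ℤ) - 2) • (b ^ k * (ε⁻¹ * E⁻¹ ^ k))) ∈ S

namespace PositiveSeed

variable {v : K} {k : ℕ} {S : Subsemiring D} {a b c d E ε : D}

lemma left_mem (h : PositiveSeed v k S a b c E ε) : a ∈ S := by
  simpa using add_mem h.left h.E_inv_mem

lemma middle_mem (h : PositiveSeed v k S a b c E ε) : b ∈ S := by
  have h1 : (E ^ (k + 1) * ε)⁻¹ ∈ S := by
    rw [mul_inv_rev, ← inv_pow]
    exact mul_mem h.ε_inv_mem (pow_mem h.E_inv_mem _)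
  simpa using add_mem h.middle h1

lemma right_mem (hS : ∀ (n : ℤ), ∀ x ∈ S, v ^ n • x ∈ S) (h : PositiveSeed v k S a b c E ε) :
    c ∈ S := by
  have h1 : E + v ^ (-3 * (k : ℤ) - 2) • (b ^ (k + 1) * a ^ k * ε⁻¹) ∈ S :=
    add_mem h.E_mem (hS _ _ (mul_mem (mul_mem (pow_mem h.middle_mem _) (pow_mem h.left_mem _))
      h.ε_inv_mem))
  simpa using add_mem h.right h1

lemma truncation_sub_mem (hv : v ≠ 0) (hS : ∀ (n : ℤ), ∀ x ∈ S, v ^ n • x ∈ S) (hb : b ≠ 0)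
    (hbc : QCommute v 2 b c) (hca : c * a = v ^ (-(k : ℤ) - 2) • b ^ (k + 2) + 1)
    (h : PositiveSeed v k S a b c E ε) (j s : ℕ) (hjs : j + s = k + 1) :
    truncation v k a b c (j + 1) s - (E ^ j * ε +
      v ^ (-2 * (k : ℤ) - 2) • (c ^ j * (b ^ k * (ε⁻¹ * E⁻¹ ^ k)))) ∈ S := by
  induction j generalizing s with
  | zero =>
    obtain rfl : s = k + 1 := by omega
    simpa using h.trunc
  | succ j ih =>
    have hmono : v ^ (-3 * (k : ℤ) - 2) • (E⁻¹ ^ j * (ε⁻¹ * (E ^ j * ε))) =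
        v ^ (-2 * (s : ℤ) - k - 2) • (1 : D) := by
      rw [(h.comm.pow_left hv j).eq, mul_smul_comm, mul_smul_comm, inv_mul_cancel_left₀ h.ε_ne,
        inv_pow, inv_mul_cancel₀ (pow_ne_zero _ h.E_ne), smul_smul, ← zpow_add₀ hv]
      congr 2
      have : (k : ℤ) = j + s := by exact_mod_cast (by omega : k = j + s)
      rw [this]
      ring
    have hk : a ^ k = a ^ s * a ^ j := by rw [← pow_add]; congr 1; omega
    have key := mul_truncation hv hb hbc hca (j + 1) s
    rw [← sub_eq_iff_eq_add] at key
    have hsplit : truncation v k a b c (j + 1 + 1) s - (E ^ (j + 1) * ε +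
        v ^ (-2 * (k : ℤ) - 2) • (c ^ (j + 1) * (b ^ k * (ε⁻¹ * E⁻¹ ^ k)))) =
        c * (truncation v k a b c (j + 1) (s + 1) - (E ^ j * ε +
          v ^ (-2 * (k : ℤ) - 2) • (c ^ j * (b ^ k * (ε⁻¹ * E⁻¹ ^ k))))) +
        (c - (E + v ^ (-3 * (k : ℤ) - 2) • (b ^ (k + 1) * a ^ k * ε⁻¹))) * (E ^ j * ε) +
        v ^ (-3 * (k : ℤ) - 2) •
          (b ^ (k + 1) * (a ^ s * ((a ^ j - E⁻¹ ^ j) * (ε⁻¹ * (E ^ j * ε))))) := by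
      rw [← key, sub_mul (a ^ j), mul_sub (a ^ s), mul_sub (b ^ (k + 1)), smul_sub,
        ← mul_smul_comm _ (b ^ (k + 1)) (a ^ s * (E⁻¹ ^ j * _)),
        ← mul_smul_comm _ (a ^ s) (E⁻¹ ^ j * _), hmono, hk]
      simp only [mul_smul_comm, mul_one, mul_sub, sub_mul, mul_add, add_mul, smul_mul_assoc,
        mul_assoc, pow_succ']
      abel
    rw [hsplit]
    have hE : E ^ j * ε ∈ S := mul_mem (pow_mem h.E_mem _) h.ε_mem
    exact add_mem (add_mem (mul_mem (h.right_mem hS) (ih _ (by omega))) (mul_mem h.right hE))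
      (hS _ _ (mul_mem (pow_mem h.middle_mem _) (mul_mem (pow_mem h.left_mem _)
        (mul_mem (Subsemiring.pow_sub_pow_mem h.left h.E_inv_mem _)
          (mul_mem h.ε_inv_mem hE)))))

lemma next (hv : v ≠ 0) (hS : ∀ (n : ℤ), ∀ x ∈ S, v ^ n • x ∈ S) (hb : b ≠ 0) (hc : c ≠ 0)
    (hbc : QCommute v 2 b c) (hca : c * a = v ^ (-(k : ℤ) - 2) • b ^ (k + 2) + 1)
    (hac : a * c = v ^ ((k : ℤ) + 2) • b ^ (k + 2) + 1)
    (hbd : b * d = v ^ ((k : ℤ) + 2) • c ^ (k + 2) + 1)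
    (h : PositiveSeed v k S a b c E ε) :
    PositiveSeed v k S b c d (E ^ (k + 1) * ε) (v ^ (-(k : ℤ)) • (E ^ k * ε)) := by
  have hE := h.E_ne
  have hε := h.ε_ne
  set P := E ^ k * ε with hP
  have hP0 : P ≠ 0 := mul_ne_zero (pow_ne_zero _ hE) hε
  have hEP : E ^ (k + 1) * ε = E * P := by rw [hP, pow_succ', mul_assoc]
  have hPS : P ∈ S := mul_mem (pow_mem h.E_mem _) h.ε_mem
  have hPinv : P⁻¹ = ε⁻¹ * E⁻¹ ^ k := by rw [hP, mul_inv_rev, inv_pow]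
  have hPinvS : P⁻¹ ∈ S := by
    rw [hPinv]; exact mul_mem h.ε_inv_mem (pow_mem h.E_inv_mem _)
  have hε' : (v ^ (-(k : ℤ)) • P)⁻¹ = v ^ (k : ℤ) • P⁻¹ := by
    rw [smul_inv₀]; simp
  have hcommP : QCommute v 2 E P := by
    have h0 : QCommute v 0 E E := by simp [QCommute]
    simpa using (h0.pow_right hv k).mul_right hv h.comm
  have hcommA : QCommute v 2 (E * P) P := by
    rw [QCommute, hcommP.eq, smul_mul_assoc, mul_assoc, hcommP.eq]
  have hinv (i : ℕ) : P⁻¹ * (E * P)⁻¹ ^ i = v ^ (-2 * (i : ℤ)) • ((E * P)⁻¹ ^ i * P⁻¹) := by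
    have := (((hcommA.symm hv).inv_left hP0 hv).inv_right (mul_ne_zero hE hP0) hv).pow_right hv i
    rw [this.eq]
    ring_nf
  have hPinv' : P⁻¹ = v ^ (-2 * (k : ℤ)) • (E⁻¹ ^ k * ε⁻¹) := by
    have := (((h.comm.symm hv).inv_left hε hv).inv_right hE hv).pow_right hv k
    rw [hPinv, this.eq]
    ring_nf
  have hd : d = truncation v k a b c (k + 2) 0 := by
    rw [← inv_mul_cancel_left₀ hb d, hbd]
    simp [truncation]
  have hAinvS : (E * P)⁻¹ ∈ S := by
    rw [mul_inv_rev]; exact mul_mem hPinvS h.E_inv_mem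
  have hmiddle := h.middle
  rw [hEP] at hmiddle ⊢
  refine ⟨mul_ne_zero hE hP0, smul_ne_zero (zpow_ne_zero _ hv) hP0, ?_, mul_mem h.E_mem hPS,
    hAinvS, hS _ _ hPS, ?_, hmiddle, ?_, ?_, ?_⟩
  · rw [QCommute, mul_smul_comm, smul_mul_assoc, hcommA.eq, smul_comm]
  · rw [hε']
    exact hS _ _ hPinvS
  · have heq : ((E * P) ^ (k + 1) * v ^ (-(k : ℤ)) • P)⁻¹ =
        v ^ (-3 * (k : ℤ) - 2) • ((E * P)⁻¹ ^ (k + 1) * E⁻¹ ^ k * ε⁻¹) := by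
      rw [mul_inv_rev, hε', ← inv_pow, smul_mul_assoc, hinv, hPinv']
      simp only [mul_smul_comm, smul_smul, ← zpow_add₀ hv, mul_assoc]
      congr 2
      push_cast
      ring
    have hsub : b ^ (k + 1) * a ^ k * ε⁻¹ - (E * P)⁻¹ ^ (k + 1) * E⁻¹ ^ k * ε⁻¹ ∈ S := by
      rw [← sub_mul]
      exact mul_mem (Subsemiring.mul_sub_mul_mem
        (Subsemiring.pow_sub_pow_mem hmiddle hAinvS _) (pow_mem hAinvS _)
        (Subsemiring.pow_sub_pow_mem h.left h.E_inv_mem _) (pow_mem h.E_inv_mem _)) h.ε_inv_mem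
    rw [heq]
    convert add_mem (add_mem h.right h.E_mem) (hS (-3 * (k : ℤ) - 2) _ hsub) using 1
    rw [smul_sub]
    abel
  · have := h.truncation_sub_mem hv hS hb hbc hca (k + 1) 0 (by omega)
    rw [← hd] at this
    convert this using 3
    · exact hEP.symm
    · rw [hε', hPinv, mul_smul_comm, smul_smul, ← zpow_add₀ hv, mul_assoc]
      congr 2
      ring
  · rw [truncation_shift hv hb hc hbc hac hbd, hε', smul_mul_assoc, hinv, mul_smul_comm,
      mul_smul_comm, smul_smul, smul_smul, ← zpow_add₀ hv, ← zpow_add₀ hv]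
    have htrunc := h.truncation_sub_mem hv hS hb hbc hca k 1 rfl
    have hsub : c ^ k * ((b ^ k - (E * P)⁻¹ ^ k) * P⁻¹) ∈ S :=
      mul_mem (pow_mem (h.right_mem hS) _)
        (mul_mem (Subsemiring.pow_sub_pow_mem hmiddle hAinvS _) hPinvS)
    rw [← hPinv, ← hP] at htrunc
    convert add_mem (hS (-(k : ℤ)) _ htrunc) (hS (-3 * (k : ℤ) - 2) _ hsub) using 1
    rw [sub_mul, mul_sub, smul_sub, smul_sub, smul_add, smul_smul, ← zpow_add₀ hv,
      show -2 * (k : ℤ) - 2 + k + -2 * k = -3 * k - 2 by ring,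
      show -(k : ℤ) + (-2 * k - 2) = -3 * k - 2 by ring]
    abel

lemma initial (hv : v ≠ 0) (hS : ∀ (n : ℤ), ∀ x ∈ S, v ^ n • x ∈ S) (ha : a ≠ 0) (hb : b ≠ 0)
    (haS : a ∈ S) (haS' : a⁻¹ ∈ S) (hbS : b ∈ S) (hbS' : b⁻¹ ∈ S) (hab : QCommute v 2 a b)
    (hac : a * c = v ^ ((k : ℤ) + 2) • b ^ (k + 2) + 1) :
    PositiveSeed v k S a b c a⁻¹ (v ^ (-2 * (k : ℤ) - 2) • (b⁻¹ * a ^ (k + 1))) := by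
  have hε : (v ^ (-2 * (k : ℤ) - 2) • (b⁻¹ * a ^ (k + 1)))⁻¹ =
      v ^ (2 * (k : ℤ) + 2) • (a⁻¹ ^ (k + 1) * b) := by
    rw [smul_inv₀, mul_inv_rev, inv_inv, ← inv_pow, ← zpow_neg]
    ring_nf
  have hab' : QCommute v 2 a⁻¹ b⁻¹ := by
    simpa using (hab.inv_left ha hv).inv_right hb hv
  have hba : QCommute v 2 b a⁻¹ := by simpa using (hab.symm hv).inv_right ha hv
  have hc : c = a⁻¹ + v ^ ((k : ℤ) + 2) • (a⁻¹ * b ^ (k + 2)) := by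
    rw [← inv_mul_cancel_left₀ ha c, hac, mul_add, mul_one, mul_smul_comm, add_comm]
  have hcancel : a ^ k * a⁻¹ ^ (k + 1) = a⁻¹ := by
    rw [pow_succ, ← mul_assoc, inv_pow, mul_inv_cancel₀ (pow_ne_zero _ ha), one_mul]
  have hcancel' : a⁻¹ ^ (k + 1) * a ^ k = a⁻¹ := by
    rw [pow_succ', mul_assoc, inv_pow, inv_mul_cancel₀ (pow_ne_zero _ ha), mul_one]
  refine ⟨inv_ne_zero ha, smul_ne_zero (zpow_ne_zero _ hv)
    (mul_ne_zero (inv_ne_zero hb) (pow_ne_zero _ ha)), ?_, haS', by simpa using haS,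
    hS _ _ (mul_mem hbS' (pow_mem haS _)), ?_, by simp, ?_, ?_, ?_⟩
  · have h0 : QCommute v 0 a⁻¹ a := by simp [QCommute, ha]
    have h1 : QCommute v 2 a⁻¹ (b⁻¹ * a ^ (k + 1)) := by
      simpa using hab'.mul_right hv (h0.pow_right hv (k + 1))
    rw [QCommute, mul_smul_comm, smul_mul_assoc, h1.eq, smul_comm]
  · rw [hε]
    exact hS _ _ (mul_mem (pow_mem haS' _) hbS)
  · have : a⁻¹ ^ (k + 1) * v ^ (-2 * (k : ℤ) - 2) • (b⁻¹ * a ^ (k + 1)) = b⁻¹ := by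
      rw [mul_smul_comm, ← mul_assoc, (hab'.pow_left hv (k + 1)).eq, smul_mul_assoc, mul_assoc,
        inv_pow, inv_mul_cancel₀ (pow_ne_zero _ ha), smul_smul, ← zpow_add₀ hv, mul_one]
      push_cast
      ring_nf
      simp
    rw [this, inv_inv, sub_self]
    exact zero_mem _
  · have : v ^ (-3 * (k : ℤ) - 2) • (b ^ (k + 1) * a ^ k *
        (v ^ (-2 * (k : ℤ) - 2) • (b⁻¹ * a ^ (k + 1)))⁻¹) =
        v ^ ((k : ℤ) + 2) • (a⁻¹ * b ^ (k + 2)) := by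
      rw [hε, mul_smul_comm, smul_smul, ← zpow_add₀ hv, mul_assoc, ← mul_assoc (a ^ k), hcancel,
        ← mul_assoc, (hba.pow_left hv (k + 1)).eq, smul_mul_assoc, smul_smul, ← zpow_add₀ hv,
        mul_assoc, ← pow_succ]
      congr 2
      push_cast
      ring
    rw [this, hc, sub_self]
    exact zero_mem _
  · have h1 : b ^ k * ((v ^ (-2 * (k : ℤ) - 2) • (b⁻¹ * a ^ (k + 1)))⁻¹ * a⁻¹⁻¹ ^ k) =
        v ^ (2 * (k : ℤ) + 2) • (a⁻¹ * b ^ (k + 1)) := by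
      rw [hε, inv_inv, smul_mul_assoc, mul_smul_comm, mul_assoc,
        ((hab.symm hv).pow_right hv k).eq, mul_smul_comm, ← mul_assoc (a⁻¹ ^ (k + 1)), hcancel',
        mul_smul_comm, ← mul_assoc, (hba.pow_left hv k).eq, smul_mul_assoc, mul_assoc,
        ← pow_succ]
      simp only [smul_smul, ← zpow_add₀ hv]
      congr 2
      ring
    have h2 : b⁻¹ * (a⁻¹ * b ^ (k + 2)) = v ^ (-2 : ℤ) • (a⁻¹ * b ^ (k + 1)) := by
      rw [← mul_assoc, (hab'.symm hv).eq, smul_mul_assoc, mul_assoc, pow_succ' b,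
        inv_mul_cancel_left₀ hb]
    have h3 : truncation v k a b c 1 (k + 1) - (v ^ (-2 * (k : ℤ) - 2) • (b⁻¹ * a ^ (k + 1)) +
        v ^ (-2 * (k : ℤ) - 2) • (b ^ k * ((v ^ (-2 * (k : ℤ) - 2) • (b⁻¹ * a ^ (k + 1)))⁻¹ *
          a⁻¹⁻¹ ^ k))) = v ^ (-(k : ℤ)) • (b⁻¹ * a⁻¹) := by
      rw [h1, truncation, hc]
      simp only [mul_add, mul_smul_comm, smul_add, smul_smul, pow_one, h2, ← zpow_add₀ hv]
      push_cast
      ring_nf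
      abel
    rw [h3]
    exact hS _ _ (mul_mem hbS' haS')

end PositiveSeed

/-- The variables with nonnegative index of a rank-two quantum cluster sequence lie in every
subsemiring containing `v ^ (±1)` and the initial cluster together with its inverses. -/
lemma quantum_cluster_variable_mem {v : K} (hv : v ≠ 0) {k : ℕ} {S : Subsemiring D}
    (hS : ∀ (n : ℤ), ∀ x ∈ S, v ^ n • x ∈ S) {x : ℕ → D} (hx : ∀ n, x n ≠ 0)
    (hexch : ∀ n, x n * x (n + 2) = v ^ ((k : ℤ) + 2) • x (n + 1) ^ (k + 2) + 1)
    (hcomm : QCommute v 2 (x 0) (x 1)) (h0 : x 0 ∈ S) (h0' : (x 0)⁻¹ ∈ S) (h1 : x 1 ∈ S)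
    (h1' : (x 1)⁻¹ ∈ S) (n : ℕ) : x n ∈ S := by
  have hright (n : ℕ) :
      x (n + 2) = (x n)⁻¹ + v ^ ((k : ℤ) + 2) • ((x n)⁻¹ * x (n + 1) ^ (k + 2)) := by
    rw [← inv_mul_cancel_left₀ (hx n) (x (n + 2)), hexch, mul_add, mul_one, mul_smul_comm,
      add_comm]
  have hcomm (n : ℕ) : QCommute v 2 (x n) (x (n + 1)) := by
    induction n with
    | zero => exact hcomm
    | succ n ih =>
      have hinv : QCommute v 2 (x (n + 1)) (x n)⁻¹ := by
        simpa using (ih.symm hv).inv_right (hx n) hv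
      rw [QCommute, hright, mul_add, add_mul, mul_smul_comm, ← mul_assoc, hinv.eq,
        smul_mul_assoc, smul_mul_assoc, mul_assoc, mul_assoc, ← pow_succ, ← pow_succ', smul_add,
        smul_comm]
  have hexch' (n : ℕ) :
      x (n + 2) * x n = v ^ (-(k : ℤ) - 2) • x (n + 1) ^ (k + 2) + 1 := by
    have hpow := ((hcomm n).symm hv).pow_left hv (k + 2)
    rw [hright, add_mul, inv_mul_cancel₀ (hx n), smul_mul_assoc, mul_assoc, hpow.eq,
      mul_smul_comm, inv_mul_cancel_left₀ (hx n), smul_smul, ← zpow_add₀ hv, add_comm]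
    congr 3
    push_cast
    ring
  have hseed (n : ℕ) : ∃ E ε, PositiveSeed v k S (x n) (x (n + 1)) (x (n + 2)) E ε := by
    induction n with
    | zero =>
      exact ⟨_, _, .initial hv hS (hx 0) (hx 1) h0 h0' h1 h1' (hcomm 0) (hexch 0)⟩
    | succ n ih =>
      obtain ⟨E, ε, h⟩ := ih
      exact ⟨_, _, h.next hv hS (hx _) (hx _) (hcomm _) (hexch' _) (hexch _) (hexch (n + 1))⟩
  obtain ⟨E, ε, h⟩ := hseed n
  exact h.left_mem

end QuantumPositivity

/-- Quantum positivity: with `v` a central unit of a division ring `D` (`q = v²`) and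
`(X n)_{n ∈ ℤ}` units of `D` satisfying `X (n-1) * X (n+1) = q^(r/2) * X n ^ r + 1` and
`X 1 * X 2 = q * X 2 * X 1`, every `X n` lies in the subsemiring of `D` generated by
`v, v⁻¹, X 1, (X 1)⁻¹, X 2, (X 2)⁻¹`: it is a subtraction-free expression in these. -/
theorem stmt6 (r : ℕ) (hr : 2 ≤ r) (D : Type*) [DivisionRing D]
    (v : Dˣ) (hv : ∀ z : D, (v : D) * z = z * (v : D))
    (X : ℤ → Dˣ)
    (hX : ∀ n : ℤ, (X (n - 1) : D) * (X (n + 1) : D) = (v : D) ^ r * (X n : D) ^ r + 1)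
    (hX12 : (X 1 : D) * (X 2 : D) = (v : D) ^ 2 * (X 2 : D) * (X 1 : D)) :
    ∀ n : ℤ, (X n : D) ∈ Subsemiring.closure
      ({(v : D), ((v⁻¹ : Dˣ) : D), ((X 1 : Dˣ) : D), (((X 1)⁻¹ : Dˣ) : D),
        ((X 2 : Dˣ) : D), (((X 2)⁻¹ : Dˣ) : D)} : Set D) := by
  set S := Subsemiring.closure
      ({(v : D), ((v⁻¹ : Dˣ) : D), ((X 1 : Dˣ) : D), (((X 1)⁻¹ : Dˣ) : D),
        ((X 2 : Dˣ) : D), (((X 2)⁻¹ : Dˣ) : D)} : Set D)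
  obtain ⟨k, rfl⟩ : ∃ k, r = k + 2 := ⟨r - 2, by omega⟩
  have hvS : (v : D) ∈ S := Subsemiring.subset_closure (by simp)
  have hvS' : (v : D)⁻¹ ∈ S := Subsemiring.subset_closure (by simp)
  have h1 : (X 1 : D) ∈ S := Subsemiring.subset_closure (by simp)
  have h1' : (X 1 : D)⁻¹ ∈ S := Subsemiring.subset_closure (by simp)
  have h2 : (X 2 : D) ∈ S := Subsemiring.subset_closure (by simp)
  have h2' : (X 2 : D)⁻¹ ∈ S := Subsemiring.subset_closure (by simp)
  let w : Subring.center D := ⟨v, Subring.mem_center_iff.2 fun z => (hv z).symm⟩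
  have hw : w ≠ 0 := fun h => v.ne_zero (congrArg Subtype.val h)
  have hsmul (n : ℕ) (z : D) : w ^ (n : ℤ) • z = (v : D) ^ n * z := by
    rw [zpow_natCast, Subring.smul_def, smul_eq_mul, SubmonoidClass.coe_pow]
  have hS (n : ℤ) (z : D) (hz : z ∈ S) : w ^ n • z ∈ S := by
    obtain ⟨i, rfl | rfl⟩ := n.eq_nat_or_neg
    · rw [hsmul]
      exact mul_mem (pow_mem hvS _) hz
    · have : w ^ (-(i : ℤ)) • z = (v : D)⁻¹ ^ i * z := by
        rw [inv_pow, eq_inv_mul_iff_mul_eq₀ (pow_ne_zero _ v.ne_zero), ← hsmul, smul_smul,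
          ← zpow_add₀ hw]
        simp
      rw [this]
      exact mul_mem (pow_mem hvS' _) hz
  have hX' (m : ℤ) :
      (X m : D) * X (m + 2) = w ^ ((k : ℤ) + 2) • (X (m + 1) : D) ^ (k + 2) + 1 := by
    have := hX (m + 1)
    rw [← hsmul, add_sub_cancel_right, add_assoc, one_add_one_eq_two] at this
    exact_mod_cast this
  have hX12' : (X 1 : D) * X 2 = w ^ (2 : ℤ) • ((X 2 : D) * X 1) := by
    rw [hX12, mul_assoc, ← hsmul]
    rfl
  intro n
  obtain hn | hn := le_total 1 n
  · obtain ⟨m, rfl⟩ := Int.le.dest hn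
    rw [add_comm]
    have e : ((1 : ℕ) : ℤ) + 1 = 2 := rfl
    refine quantum_cluster_variable_mem hw (k := k) hS (x := fun i : ℕ => (X (i + 1) : D))
      (fun i => (X _).ne_zero) (fun i => ?_) ?_ ?_ ?_ ?_ ?_ m
    · simpa [add_right_comm] using hX' (i + 1)
    · simpa [e, QCommute] using hX12'
    · simpa using h1
    · simpa using h1'
    · simpa [e] using h2
    · simpa [e] using h2'
  · obtain ⟨m, hm⟩ := Int.le.dest (show n ≤ 2 by omega)
    obtain rfl : n = 2 - m := by omega
    have e : (2 : ℤ) - (1 : ℕ) = 1 := rfl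
    refine Subsemiring.mem_op.1 (quantum_cluster_variable_mem hw (k := k) (S := S.op)
      (x := fun i : ℕ => MulOpposite.op (X (2 - i) : D)) (fun n z hz => hS n _ hz)
      (fun i => ?_) (fun i => ?_) ?_ ?_ ?_ ?_ ?_ m)
    · simp
    · have := hX' (-i)
      apply MulOpposite.unop_injective
      simp only [MulOpposite.unop_mul, MulOpposite.unop_op, MulOpposite.unop_add,
        MulOpposite.unop_smul, MulOpposite.unop_pow, MulOpposite.unop_one]
      convert this using 3 <;> push_cast <;> ring_nf
    · apply MulOpposite.unop_injective
      simpa [e] using hX12'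
    · simpa [e] using h2
    · simpa [e] using h2'
    · simpa [e] using h1
    · simpa [e] using h1'
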